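/- Let a ≤ b be real numbers and let g : ℝ → ℂ be continuous on [a, b]. Then exp(∫_a^b g(t) dt) = Σ_{n=0}^{∞} ∫_a^b g(t₁) ( ∫_{t₁}^b g(t₂) ( ⋯ ( ∫_{t_{n−1}}^b g(t_n) dt_n ) ⋯ ) dt₂ ) dt₁, where the n = 0 term of the series is 1 and the series converges absolutely. -/

import Mathlib

open MeasureTheory intervalIntegral

/-- The `n`-fold time-ordered iterated integral of `g` from `a` to `b`:
`iterInt g b n a = ∫_a^b g(t₁) ∫_{t₁}^b g(t₂) ⋯ ∫_{t_{n-1}}^b g(t_n) dt_n ⋯ dt₁`,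
with `iterInt g b 0 a = 1`. -/
noncomputable def iterInt (g : ℝ → ℂ) (b : ℝ) : ℕ → ℝ → ℂ
  | 0 => fun _ => 1
  | n + 1 => fun a => ∫ t in a..b, g t * iterInt g b n t

theorem iterInt_of_continuous (G : ℝ → ℂ) (hG : Continuous G) (b : ℝ) (n : ℕ) :
    ∀ x, iterInt G b n x = (∫ t in x..b, G t) ^ n / (n.factorial : ℂ) := by
  have hF : ∀ x, HasDerivAt (fun x => ∫ t in x..b, G t) (-G x) x := fun x =>
    intervalIntegral.integral_hasDerivAt_left (hG.intervalIntegrable _ _)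
      (hG.stronglyMeasurableAtFilter _ _) hG.continuousAt
  have hFc : Continuous (fun x => ∫ t in x..b, G t) :=
    continuous_iff_continuousAt.2 fun x => (hF x).continuousAt
  induction n with
  | zero => intro x; simp [iterInt]
  | succ n ih =>
    intro x
    simp only [iterInt, ih]
    have hd : ∀ t ∈ Set.uIcc x b, HasDerivAt
        (fun t => -((∫ s in t..b, G s) ^ (n + 1) / ((n + 1).factorial : ℂ)))
        (G t * ((∫ s in t..b, G s) ^ n / (n.factorial : ℂ))) t := by
      intro t _
      have h := (((hF t).pow (n + 1)).div_const ((n + 1).factorial : ℂ)).neg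
      refine h.congr_deriv ?_
      have h1 : (n.factorial : ℂ) ≠ 0 := by exact_mod_cast n.factorial_ne_zero
      have h2 : (n : ℂ) + 1 ≠ 0 := by exact_mod_cast n.succ_ne_zero
      rw [Nat.factorial_succ]
      push_cast
      field_simp
    rw [intervalIntegral.integral_eq_sub_of_hasDerivAt hd
      ((hG.mul ((hFc.pow n).div_const _)).intervalIntegrable _ _)]
    simp

theorem iterInt_congr_Icc (g G : ℝ → ℂ) (a b : ℝ) (h : Set.EqOn g G (Set.Icc a b)) (n : ℕ) :
    ∀ x ∈ Set.Icc a b, iterInt g b n x = iterInt G b n x := by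
  induction n with
  | zero => intro x _; rfl
  | succ n ih =>
    intro x hx
    simp only [iterInt]
    refine intervalIntegral.integral_congr fun t ht => ?_
    rw [Set.uIcc_of_le hx.2] at ht
    have ht' : t ∈ Set.Icc a b := ⟨hx.1.trans ht.1, ht.2⟩
    simp only [h ht', ih t ht']

/-- For `a ≤ b` and `g` continuous on `[a, b]`,
`exp (∫_a^b g) = ∑_{n=0}^∞ ∫_a^b g(t₁) ∫_{t₁}^b g(t₂) ⋯ ∫_{t_{n-1}}^b g(t_n) dt_n ⋯ dt₁`,
where the `n = 0` term is `1` and the series converges absolutely. -/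
theorem exp_integral_eq_tsum_orderedIterInt
    (a b : ℝ) (hab : a ≤ b) (g : ℝ → ℂ) (hg : ContinuousOn g (Set.Icc a b)) :
    HasSum (fun n : ℕ => iterInt g b n a) (Complex.exp (∫ t in a..b, g t)) ∧
      Summable (fun n : ℕ => ‖iterInt g b n a‖) := by
  have hE : Set.EqOn g (Set.IccExtend hab (Set.domRestrict (Set.Icc a b) g)) (Set.Icc a b) := by
    intro x hx
    rw [Set.IccExtend_of_mem _ _ hx]
    rfl
  have hc : Continuous (Set.IccExtend hab (Set.domRestrict (Set.Icc a b) g)) :=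
    (continuousOn_iff_continuous_domRestrict.1 hg).Icc_extend'
  have key : ∀ n, iterInt g b n a = (∫ t in a..b, g t) ^ n / (n.factorial : ℂ) := by
    intro n
    rw [iterInt_congr_Icc g _ a b hE n a (Set.left_mem_Icc.2 hab),
      iterInt_of_continuous _ hc b n a]
    congr 2
    refine intervalIntegral.integral_congr fun t ht => ?_
    rw [Set.uIcc_of_le hab] at ht
    exact (hE ht).symm
  simp only [key]
  constructor
  · rw [Complex.exp_eq_exp_ℂ]
    exact NormedSpace.expSeries_div_hasSum_exp _
  · exact NormedSpace.norm_expSeries_div_summable _
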